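/- For all real a with a ∉ πℤ and all real b ≠ 0, ∫_{-∞}^{∞} e^{ibξ} / sinh⁴(ξ + ia) dξ = (π(b³ + 4b)/3) · e^{b[a]_π} / (e^{bπ} − 1), where [a]_π ∈ [0, π) is defined by a = n₀π + [a]_π for integer n₀. -/

import Mathlib

open MeasureTheory Complex
lemma nsq (x y : ℝ) : ‖sinh ((x:ℂ) + I * y)‖ ^ 2 = Real.sinh x ^ 2 + Real.sin y ^ 2 := by
  have : sinh ((x:ℂ) + I * y) = ((Real.sinh x * Real.cos y : ℝ) : ℂ) + ((Real.cosh x * Real.sin y : ℝ):ℂ) * I := by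
    rw [mul_comm I, sinh_add, sinh_mul_I, cosh_mul_I]; push_cast; ring
  rw [this, ← normSq_eq_norm_sq, normSq_add_mul_I]
  have h1 := Real.cosh_sq x
  have h2 := Real.sin_sq_add_cos_sq y
  rw [mul_pow, mul_pow, h1]
  linear_combination Real.sinh x ^ 2 * h2

lemma sinh_sq_ge (x : ℝ) : x ^ 2 ≤ Real.sinh x ^ 2 := by
  rw [sq_le_sq, Real.abs_sinh]
  exact Real.self_le_sinh_iff.2 (abs_nonneg x)

lemma norm4 (x y : ℝ) : ‖sinh ((x:ℂ) + I * y)‖ ^ 4 = (Real.sinh x ^ 2 + Real.sin y ^ 2) ^ 2 := by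
  rw [← nsq]; ring

/-- integrand in the shifted variable -/
noncomputable def F (b : ℝ) (z : ℂ) : ℂ := exp (I * b * z) / sinh z ^ 4

lemma normF (b x y : ℝ) : ‖F b (x + y * I)‖ = Real.exp (-(b * y)) / (Real.sinh x ^ 2 + Real.sin y ^ 2) ^ 2 := by
  rw [F, norm_div, norm_pow, mul_comm (y:ℂ), norm4, norm_exp]
  congr 2; simp

lemma sin_pos' {y : ℝ} (h0 : 0 < y) (h1 : y < Real.pi) (x : ℝ) : sinh ((x:ℂ) + y * I) ≠ 0 := by
  intro h
  have := nsq x y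
  rw [mul_comm I, h] at this
  have h2 := Real.sin_pos_of_pos_of_lt_pi h0 h1
  simp at this
  nlinarith [sq_nonneg (Real.sinh x), sq_pos_of_pos h2]

lemma F_cont (b : ℝ) {y : ℝ} (h0 : 0 < y) (h1 : y < Real.pi) : Continuous fun x : ℝ => F b (x + y * I) := by
  unfold F
  refine Continuous.div (by fun_prop) ?_ fun x => pow_ne_zero _ (sin_pos' h0 h1 x)
  exact (continuous_sinh.comp (by fun_prop)).pow 4

lemma F_int (b : ℝ) {y : ℝ} (h0 : 0 < y) (h1 : y < Real.pi) : Integrable fun x : ℝ => F b (x + y * I) := by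
  have hs := Real.sin_pos_of_pos_of_lt_pi h0 h1
  refine Integrable.mono' (integrable_inv_one_add_sq.const_mul (Real.exp (-(b*y)) / Real.sin y ^ 4))
    (F_cont b h0 h1).aestronglyMeasurable (Filter.Eventually.of_forall fun x => ?_)
  rw [normF, div_mul_eq_mul_div, ← div_eq_mul_inv, div_div]
  have h3 : Real.sin y ^ 2 * (1 + x^2) ≤ Real.sinh x ^ 2 + Real.sin y ^ 2 := by
    nlinarith [sinh_sq_ge x, Real.sin_sq_le_one y, sq_nonneg x, sq_nonneg (Real.sin y)]
  refine div_le_div_of_nonneg_left (Real.exp_pos _).le (by positivity) ?_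
  calc (1 + x^2) * Real.sin y ^ 4 ≤ (1+x^2)^2 * Real.sin y ^ 4 := by
        gcongr; nlinarith [sq_nonneg x]
    _ = (Real.sin y ^ 2 * (1 + x^2))^2 := by ring
    _ ≤ _ := by gcongr

lemma vert (b : ℝ) {y₁ y₂ : ℝ} (h : y₁ ∈ Set.Ioo 0 Real.pi) (h' : y₂ ∈ Set.Ioo 0 Real.pi)
    (R : ℝ) (hR : R ≠ 0) : ‖∫ y in y₁..y₂, F b (R + y * I)‖ ≤ Real.exp (|b| * Real.pi) / R ^ 4 * |y₂ - y₁| := by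
  refine intervalIntegral.norm_integral_le_of_norm_le_const fun y hy => ?_
  have hy' : y ∈ Set.Ioo 0 Real.pi := by
    rcases Set.mem_uIoc.1 hy with ⟨p, q⟩ | ⟨p, q⟩
    · exact ⟨h.1.trans p, q.trans_lt h'.2⟩
    · exact ⟨h'.1.trans p, q.trans_lt h.2⟩
  rw [normF]
  gcongr
  · nlinarith [neg_abs_le b, abs_nonneg b, hy'.1, hy'.2]
  · nlinarith [sinh_sq_ge R, sq_nonneg (Real.sin y), sq_nonneg R]

lemma shift (b : ℝ) {y₁ y₂ : ℝ} (h : y₁ ∈ Set.Ioo 0 Real.pi) (h' : y₂ ∈ Set.Ioo 0 Real.pi) :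
    ∫ x : ℝ, F b (x + y₁ * I) = ∫ x : ℝ, F b (x + y₂ * I) := by
  have key : ∀ R : ℝ, (∫ x in -R..R, F b (x + y₁ * I)) - (∫ x in -R..R, F b (x + y₂ * I)) =
      -(I • ∫ y in y₁..y₂, F b (R + y * I)) + I • ∫ y in y₁..y₂, F b ((-R : ℝ) + y * I) := by
    intro R
    have := integral_boundary_rect_eq_zero_of_differentiableOn (F b) ⟨-R, y₁⟩ ⟨R, y₂⟩ ?_
    · simp only at this
      linear_combination this
    · intro z hz
      rw [mem_reProdIm] at hz
      have hz2 : z.im ∈ Set.Ioo 0 Real.pi := (Set.OrdConnected.uIcc_subset Set.ordConnected_Ioo h h') hz.2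
      refine DifferentiableAt.differentiableWithinAt ?_
      unfold F
      refine DifferentiableAt.div (by fun_prop) (by fun_prop) (pow_ne_zero _ ?_)
      rw [← re_add_im z]
      exact sin_pos' hz2.1 hz2.2 _
  have T1 := intervalIntegral_tendsto_integral (F_int b h.1 h.2) Filter.tendsto_neg_atTop_atBot Filter.tendsto_id
  have T2 := intervalIntegral_tendsto_integral (F_int b h'.1 h'.2) Filter.tendsto_neg_atTop_atBot Filter.tendsto_id
  have T3 : Filter.Tendsto (fun R : ℝ => 2 * (Real.exp (|b| * Real.pi) / R ^ 4 * |y₂ - y₁|)) Filter.atTop (nhds 0) := by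
    have : Filter.Tendsto (fun R : ℝ => 2 * (Real.exp (|b| * Real.pi) / R ^ 4 * |y₂ - y₁|)) Filter.atTop (nhds (2 * (0 * |y₂ - y₁|))) := by
      refine Filter.Tendsto.const_mul _ (Filter.Tendsto.mul_const _ ?_)
      exact Filter.Tendsto.div_atTop tendsto_const_nhds (Filter.tendsto_pow_atTop (by norm_num))
    simpa using this
  have T4 : Filter.Tendsto (fun R : ℝ => (∫ x in -R..R, F b (x + y₁ * I)) - (∫ x in -R..R, F b (x + y₂ * I))) Filter.atTop (nhds 0) := by
    refine squeeze_zero_norm' ?_ T3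
    filter_upwards [Filter.eventually_gt_atTop 0] with R hR
    rw [key]
    refine (norm_add_le _ _).trans ?_
    rw [norm_neg, norm_smul, norm_smul, norm_I, one_mul, one_mul, two_mul]
    refine add_le_add (vert b h h' R hR.ne') ?_
    have := vert b h h' (-R) (neg_ne_zero.2 hR.ne')
    rwa [Even.neg_pow (by decide)] at this
  exact sub_eq_zero.1 (tendsto_nhds_unique (T1.sub T2) T4)

lemma sig1 (x : ℝ) : Real.sigmoid (2 * x) = Real.exp (x - Real.log (2 * Real.cosh x)) := by
  have := Real.cosh_pos x
  rw [Real.exp_sub, Real.exp_log (by positivity), Real.sigmoid_def, Real.cosh_eq]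
  have h : Real.exp (-(2 * x)) = Real.exp (-x) * Real.exp (-x) := by rw [← Real.exp_add]; ring_nf
  have h' : Real.exp x * Real.exp (-x) = 1 := by rw [← Real.exp_add]; simp
  have := Real.exp_pos x
  have := Real.exp_pos (-x)
  rw [h, inv_eq_one_div, div_eq_div_iff (by positivity) (by positivity)]
  linear_combination (-Real.exp (-x)) * h'

lemma sig2 (x : ℝ) : 1 - Real.sigmoid (2 * x) = Real.exp (-x - Real.log (2 * Real.cosh x)) := by
  rw [← Real.sigmoid_neg, ← mul_neg, sig1, Real.cosh_neg]

lemma beta_eq (b : ℝ) : betaIntegral (2 + I * b / 2) (2 - I * b / 2)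
    = ∫ x : ℝ, (1 / 8 : ℂ) * (exp (I * b * x) / cosh x ^ 4) := by
  rw [betaIntegral, intervalIntegral.integral_of_le zero_le_one, integral_Ioc_eq_integral_Ioo]
  have himg : (fun x : ℝ => Real.sigmoid (2 * x)) '' Set.univ = Set.Ioo 0 1 := by
    rw [Set.image_univ, ← Real.range_sigmoid]
    exact (mul_left_surjective₀ (two_ne_zero : (2:ℝ) ≠ 0)).range_comp Real.sigmoid
  rw [← himg, integral_image_eq_integral_abs_deriv_smul (f' := fun x : ℝ => 2 * (Real.sigmoid (2 * x) * (1 - Real.sigmoid (2 * x))))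
    MeasurableSet.univ, setIntegral_univ]
  · refine integral_congr_ae (Filter.Eventually.of_forall fun x => ?_)
    have hc := Real.cosh_pos x
    have hpos : 0 ≤ 2 * (Real.sigmoid (2 * x) * (1 - Real.sigmoid (2 * x))) := by
      rw [sig2, sig1]; positivity
    have e : (1 - ((Real.sigmoid (2 * x) : ℝ) : ℂ)) = ((1 - Real.sigmoid (2 * x) : ℝ) : ℂ) := by push_cast; rfl
    simp only [abs_of_nonneg hpos, e]
    rw [sig2, sig1, cpow_def_of_ne_zero (by exact_mod_cast (Real.exp_pos _).ne'),
      cpow_def_of_ne_zero (by exact_mod_cast (Real.exp_pos _).ne'), ← ofReal_log (Real.exp_pos _).le,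
      ← ofReal_log (Real.exp_pos _).le, Real.log_exp, Real.log_exp, real_smul]
    have e4 : ((Real.cosh x : ℝ) : ℂ) ^ 4 = exp (Real.log (2 * Real.cosh x) : ℝ) ^ 4 / 16 := by
      rw [← ofReal_exp, Real.exp_log (by positivity)]; push_cast; ring
    rw [← ofReal_cosh, e4]
    push_cast
    rw [← exp_add, ← exp_add, ← exp_nat_mul]
    have : ∀ p q : ℂ, (1 / 8 : ℂ) * (exp p / (exp q / 16)) = 2 * exp (p - q) := by
      intro p q; rw [exp_sub]; field_simp; norm_num
    rw [this, mul_assoc, ← exp_add]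
    congr 2
    push_cast
    ring
  · intro x _
    have := (Real.hasDerivAt_sigmoid (2 * x)).comp x ((hasDerivAt_id x).const_mul 2)
    refine HasDerivAt.hasDerivWithinAt ?_
    have e2 : 2 * (Real.sigmoid (2 * x) * (1 - Real.sigmoid (2 * x))) = Real.sigmoid (2 * x) * (1 - Real.sigmoid (2 * x)) * (2 * 1) := by ring
    rw [e2]; exact this
  · intro x _ y _ h
    have := Real.sigmoid_injective h
    linarith

lemma beta_val (b : ℝ) (hb : b ≠ 0) : betaIntegral (2 + I * b / 2) (2 - I * b / 2)
    = (Real.pi * (b ^ 3 + 4 * b) / 48 / Real.sinh (Real.pi * b / 2) : ℝ) := by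
  set s : ℂ := I * b / 2 with hs
  have hbc : (b : ℂ) ≠ 0 := by exact_mod_cast hb
  have hre : s.re = 0 := by simp [hs]
  have hs0 : s ≠ 0 := by simp [hs, hbc]
  have h1s : 1 + s ≠ 0 := fun h => by have := congrArg re h; simp [hre] at this
  have h1s' : 1 - s ≠ 0 := fun h => by have := congrArg re h; simp [hre] at this
  have h := Gamma_mul_Gamma_eq_betaIntegral (s := 2 + s) (t := 2 - s) (by simp [hre]) (by simp [hre])
  have g4 : Gamma (2 + s + (2 - s)) = 6 := by
    have : (2 + s + (2 - s)) = ((3 : ℕ) : ℂ) + 1 := by push_cast; ring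
    rw [this, Gamma_nat_eq_factorial]; norm_num [Nat.factorial]
  have g1 : Gamma (2 + s) = (1 + s) * (s * Gamma s) := by
    rw [← Gamma_add_one s hs0, show 2 + s = (1 + s) + 1 by ring, Gamma_add_one _ h1s, add_comm s 1]
  have g2 : Gamma (2 - s) = (1 - s) * Gamma (1 - s) := by
    rw [← Gamma_add_one _ h1s']; congr 1; ring
  have g3 := Gamma_mul_Gamma_one_sub s
  have hsin : sin (Real.pi * s) = (Real.sinh (Real.pi * b / 2) : ℝ) * I := by
    rw [ofReal_sinh, ← sin_mul_I]; congr 1; rw [hs]; push_cast; ring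
  have hsh : ((Real.sinh (Real.pi * b / 2) : ℝ) : ℂ) ≠ 0 := by
    rw [ofReal_ne_zero, Real.sinh_ne_zero]
    have := Real.pi_ne_zero
    positivity
  rw [g4, g1, g2] at h
  rw [hsin] at g3
  have hB : betaIntegral (2 + s) (2 - s) = (1 + s) * (1 - s) * s * (Gamma s * Gamma (1 - s)) / 6 := by
    linear_combination (-1/6) * h
  rw [hB, g3, ofReal_div]
  have hI := I_ne_zero
  push_cast at hsh ⊢
  field_simp
  rw [hs]
  ring_nf
  simp only [I_pow_three]
  ring

lemma mid (b : ℝ) (hb : b ≠ 0) : ∫ x : ℝ, F b (x + (Real.pi / 2 : ℝ) * I) =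
    (Real.pi * (b ^ 3 + 4 * b) / 3 / (Real.exp (b * Real.pi) - 1) : ℝ) := by
  have e : ∀ x : ℝ, F b (x + (Real.pi / 2 : ℝ) * I) =
      (8 * exp (-(b * Real.pi / 2))) * ((1 / 8 : ℂ) * (exp (I * b * x) / cosh x ^ 4)) := by
    intro x
    have h1 : sinh ((x : ℂ) + (Real.pi / 2 : ℝ) * I) = cosh x * I := by
      rw [sinh_add, sinh_mul_I, cosh_mul_I]; push_cast; simp
    have h2 : I * b * ((x : ℂ) + (Real.pi / 2 : ℝ) * I) = -(b * Real.pi / 2) + I * b * x := by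
      push_cast
      linear_combination (b * Real.pi / 2 : ℂ) * I_sq
    rw [F, h1, h2, exp_add, mul_pow, I_pow_four]
    ring
  simp_rw [e]
  rw [integral_const_mul, ← beta_eq, beta_val b hb]
  have : exp (-(b * Real.pi / 2)) = (Real.exp (-(Real.pi * b / 2)) : ℝ) := by
    push_cast; congr 1; ring
  rw [this]
  norm_cast
  rw [Real.sinh_eq]
  have h1 : Real.exp (b * Real.pi) = Real.exp (Real.pi * b / 2) ^ 2 := by
    rw [← Real.exp_nat_mul]; congr 1; push_cast; ring
  rw [h1, Real.exp_neg]
  have hne : Real.exp (Real.pi * b / 2) ^ 2 - 1 ≠ 0 := by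
    rw [← h1, sub_ne_zero]
    simp [hb, Real.pi_ne_zero]
  set E := Real.exp (Real.pi * b / 2)
  have hE : E ≠ 0 := (Real.exp_pos _).ne'
  have : E - E⁻¹ = (E ^ 2 - 1) / E := by field_simp
  rw [this]
  field_simp
  norm_num

lemma sinh_shift (z : ℂ) (n : ℤ) : sinh (z + n * (Real.pi * I)) ^ 4 = sinh z ^ 4 := by
  have hp : Function.Periodic (fun w : ℂ => sinh w ^ 4) (Real.pi * I) := by
    intro w
    simp only [sinh_add_pi_mul_I]
    ring
  exact hp.int_mul n z

theorem stmt15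
    (a b : ℝ) (ha : ∀ n : ℤ, a ≠ n * Real.pi) (hb : b ≠ 0)
    (aπ : ℝ) (haπ : aπ = Real.pi * Int.fract (a / Real.pi)) :
    (∫ ξ : ℝ, Complex.exp (Complex.I * b * ξ) / Complex.sinh (↑ξ + Complex.I * a) ^ 4)
      = ((Real.pi * (b ^ 3 + 4 * b) / 3 * Real.exp (b * aπ)
          / (Real.exp (b * Real.pi) - 1) : ℝ) : ℂ) := by
  set n := ⌊a / Real.pi⌋ with hn
  have hpi := Real.pi_pos
  have hdec : a = aπ + n * Real.pi := by
    have := Int.fract_add_floor (a / Real.pi)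
    rw [haπ, hn]
    field_simp at this ⊢
    linarith
  have hmem : aπ ∈ Set.Ioo 0 Real.pi := by
    have h1 := Int.fract_nonneg (a / Real.pi)
    have h2 := Int.fract_lt_one (a / Real.pi)
    refine ⟨lt_of_le_of_ne (by rw [haπ]; positivity) fun h => ?_, by rw [haπ]; nlinarith⟩
    exact ha n (by rw [hdec, ← h]; ring)
  have hmid : Real.pi / 2 ∈ Set.Ioo 0 Real.pi := ⟨by linarith, by linarith⟩
  have e : ∀ ξ : ℝ, Complex.exp (Complex.I * b * ξ) / Complex.sinh (↑ξ + Complex.I * a) ^ 4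
      = (Real.exp (b * aπ) : ℝ) * F b (ξ + aπ * I) := by
    intro ξ
    have h1 : (ξ : ℂ) + I * a = (ξ + aπ * I) + n * (Real.pi * I) := by
      rw [hdec]; push_cast; ring
    have h2 : I * b * (ξ : ℂ) = (b * aπ : ℝ) + I * b * (ξ + aπ * I) := by
      push_cast
      linear_combination (-(b * aπ) : ℂ) * I_sq
    rw [h1, sinh_shift, h2, exp_add, F, ofReal_exp]
    ring
  simp_rw [e]
  rw [integral_const_mul, shift b hmem hmid, mid b hb, ← ofReal_mul]
  congr 1
  ring
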